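/- Let n ≥ 2 and let G ⊆ M_n(ℂ) be an irreducible multiplicative group of invertible matrices such that every member of G has nonnegative diagonal entries. Then there exists an invertible diagonal matrix D ∈ M_n(ℂ) such that every matrix in D G D⁻¹ has all entries nonnegative real; moreover, every matrix in D G D⁻¹ is a nonnegative monomial matrix (exactly one nonzero entry in each row and in each column, and that entry is a positive real number). -/

import Mathlib

open Matrix

section CompactSemigroups

open scoped Matrix.Norms.Elementwise

variable {m : Type*} [Fintype m]

/-- The squared Frobenius norm. -/
noncomputable def frobSq (X : Matrix m m ℂ) : ℝ := ∑ i, ∑ j, Complex.normSq (X i j)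

theorem continuous_frobSq : Continuous (frobSq : Matrix m m ℂ → ℝ) := by
  unfold frobSq
  refine continuous_finsetSum _ fun i _ => continuous_finsetSum _ fun j _ => ?_
  exact Complex.continuous_normSq.comp (continuous_id.matrix_elem i j)

theorem frobSq_nonneg (X : Matrix m m ℂ) : 0 ≤ frobSq X :=
  Finset.sum_nonneg fun _ _ => Finset.sum_nonneg fun _ _ => Complex.normSq_nonneg _

theorem eq_zero_of_frobSq_eq_zero {X : Matrix m m ℂ} (h : frobSq X = 0) : X = 0 := by
  have h0 : ∀ i j, Complex.normSq (X i j) = 0 := by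
    intro i j
    refine le_antisymm (h ▸ ?_) (Complex.normSq_nonneg _)
    refine (Finset.single_le_sum (f := fun j => Complex.normSq (X i j))
      (fun _ _ => Complex.normSq_nonneg _) (Finset.mem_univ j)).trans ?_
    exact Finset.single_le_sum (f := fun i => ∑ j, Complex.normSq (X i j))
      (fun _ _ => Finset.sum_nonneg fun _ _ => Complex.normSq_nonneg _) (Finset.mem_univ i)
  ext i j
  exact Complex.normSq_eq_zero.mp (h0 i j)

theorem frobSq_midpoint (X Y : Matrix m m ℂ) :
    frobSq ((1 / 2 : ℝ) • X + (1 / 2 : ℝ) • Y) =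
      frobSq X / 2 + frobSq Y / 2 - frobSq (X - Y) / 4 := by
  simp only [frobSq, Finset.sum_div, ← Finset.sum_add_distrib, ← Finset.sum_sub_distrib]
  refine Finset.sum_congr rfl fun i _ => Finset.sum_congr rfl fun j _ => ?_
  simp [Complex.normSq_apply]
  ring

variable [DecidableEq m]

theorem exists_left_inverse_of_isCompact_semigroup {K : Set (Matrix m m ℂ)} (hK : IsCompact K)
    (hmul : ∀ A ∈ K, ∀ B ∈ K, A * B ∈ K) (hdet : ∀ A ∈ K, A.det ≠ 0) {A : Matrix m m ℂ}
    (hA : A ∈ K) : ∃ B ∈ K, B * A = 1 := by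
  obtain ⟨E, ⟨B, hB, rfl⟩, hE⟩ := exists_idempotent_in_compact_subsemigroup
    (fun R => continuous_id.matrix_mul continuous_const) ((fun B => B * A) '' K)
    (Set.Nonempty.image _ ⟨A, hA⟩) (hK.image (continuous_id.matrix_mul continuous_const))
    (by
      rintro _ ⟨B, hB, rfl⟩ _ ⟨C, hC, rfl⟩
      exact ⟨B * A * C, hmul _ (hmul _ hB _ hA) _ hC, by simp only [Matrix.mul_assoc]⟩)
  refine ⟨B, hB, ?_⟩
  have hu : IsUnit (B * A) := by
    rw [Matrix.isUnit_iff_isUnit_det]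
    exact (hdet _ (hmul _ hB _ hA)).isUnit
  exact hu.mul_left_cancel (by simpa using hE)

/-- A compact group of matrices with nonnegative traces fixes a nonzero matrix. -/
theorem exists_fixed_matrix_of_isCompact_semigroup [Nonempty m] {K : Set (Matrix m m ℂ)}
    (hK : IsCompact K) (hne : K.Nonempty)
    (hmul : ∀ A ∈ K, ∀ B ∈ K, A * B ∈ K) (hdet : ∀ A ∈ K, A.det ≠ 0)
    (htr : ∀ A ∈ K, 0 ≤ (trace A).re) :
    ∃ X : Matrix m m ℂ, X ≠ 0 ∧ ∀ A ∈ K, A * X = X := by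
  have hinv := fun A hA => exists_left_inverse_of_isCompact_semigroup hK hmul hdet (A := A) hA
  have hctr : ∀ B : Matrix m m ℂ, Continuous fun X : Matrix m m ℂ => (trace (B * X)).re :=
    fun B => Complex.continuous_re.comp (continuous_const.matrix_mul continuous_id).matrix_trace
  -- a linear functional which is bounded below on `K`
  obtain ⟨s, hsK, hs⟩ : ∃ s : Finset (Matrix m m ℂ), (∀ B ∈ s, B ∈ K) ∧
      ∀ A ∈ K, 0 < ∑ B ∈ s, (trace (B * A)).re := by
    classical
    obtain ⟨t, ht⟩ := hK.elim_finite_subcover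
      (fun B : K => {X : Matrix m m ℂ | 0 < (trace ((B : Matrix m m ℂ) * X)).re})
      (fun B => isOpen_lt continuous_const (hctr B)) (by
        intro A hA
        obtain ⟨B, hB, hBA⟩ := hinv A hA
        refine Set.mem_iUnion.mpr ⟨⟨B, hB⟩, ?_⟩
        simp [hBA, Fintype.card_pos])
    refine ⟨t.image Subtype.val, ?_, fun A hA => ?_⟩
    · intro B hB
      obtain ⟨b, -, rfl⟩ := Finset.mem_image.mp hB
      exact b.2
    · obtain ⟨b, hb, hbA⟩ := Set.mem_iUnion₂.mp (ht hA)
      refine Finset.sum_pos' (fun B hB => ?_) ⟨b, Finset.mem_image_of_mem _ hb, hbA⟩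
      obtain ⟨b, -, rfl⟩ := Finset.mem_image.mp hB
      exact htr _ (hmul _ b.2 _ hA)
  have hcs : Continuous fun X : Matrix m m ℂ => ∑ B ∈ s, (trace (B * X)).re :=
    continuous_finsetSum _ fun B _ => hctr B
  obtain ⟨A₀, hA₀, hmin⟩ := hK.exists_isMinOn hne hcs.continuousOn
  set L := closedConvexHull ℝ K with hL
  have hLconv : Convex ℝ L := convex_closedConvexHull
  have hLc : IsClosed L := isClosed_closedConvexHull
  have hKL : K ⊆ L := subset_closedConvexHull
  have hLlow : ∀ X ∈ L, ∑ B ∈ s, (trace (B * A₀)).re ≤ ∑ B ∈ s, (trace (B * X)).re := by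
    have : L ⊆ {X | ∑ B ∈ s, (trace (B * A₀)).re ≤ ∑ B ∈ s, (trace (B * X)).re} := by
      refine closedConvexHull_min (fun A hA => hmin hA) ?_ (isClosed_le continuous_const hcs)
      refine convex_halfSpace_ge (𝕜 := ℝ) ⟨fun X Y => ?_, fun c X => ?_⟩ _
      · simp [Matrix.mul_add, Finset.sum_add_distrib]
      · simp [Finset.mul_sum]
    exact this
  have hLmul : ∀ A ∈ K, ∀ X ∈ L, A * X ∈ L := by
    intro A hA
    have : L ⊆ (LinearMap.mulLeft ℝ A) ⁻¹' L := by
      refine closedConvexHull_min (fun B hB => hKL (hmul A hA B hB))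
        (hLconv.linear_preimage (LinearMap.mulLeft ℝ A)) (hLc.preimage ?_)
      exact continuous_const.matrix_mul continuous_id
    exact this
  have hLcpt : IsCompact L := by
    refine Metric.isCompact_of_isClosed_isBounded hLc ?_
    rw [hL, closedConvexHull_eq_closure_convexHull]
    exact (isBounded_convexHull.mpr hK.isBounded).closure
  -- an invariant strictly convex gauge and its minimiser
  have hcq : Continuous fun p : Matrix m m ℂ × Matrix m m ℂ => frobSq (p.2 * p.1) :=
    continuous_frobSq.comp (continuous_snd.matrix_mul continuous_fst)
  have hbdd : ∀ X, BddAbove ((fun A => frobSq (A * X)) '' K) := fun X =>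
    (hK.image (continuous_frobSq.comp (continuous_id.matrix_mul continuous_const))).bddAbove
  obtain ⟨X, hX, hXmin⟩ := hLcpt.exists_isMinOn (hne.mono hKL)
    (IsCompact.continuous_sSup (f := fun X A => frobSq (A * X)) hK hcq).continuousOn
  refine ⟨X, ?_, fun A hA => ?_⟩
  · rintro rfl
    have h1 := hLlow _ hX
    have h2 := hs A₀ hA₀
    simp at h1
    linarith
  set c := sSup ((fun A => frobSq (A * X)) '' K) with hc
  have hle : ∀ B ∈ K, frobSq (B * X) ≤ c := fun B hB =>
    le_csSup (hbdd X) (Set.mem_image_of_mem _ hB)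
  have hmid : (1 / 2 : ℝ) • X + (1 / 2 : ℝ) • (A * X) ∈ L :=
    hLconv hX (hLmul A hA X hX) (by norm_num) (by norm_num) (by norm_num)
  obtain ⟨B, hB, hBmax⟩ := hK.exists_sSup_image_eq hne
    (f := fun B => frobSq (B * ((1 / 2 : ℝ) • X + (1 / 2 : ℝ) • (A * X))))
    (continuous_frobSq.comp (continuous_id.matrix_mul continuous_const)).continuousOn
  have h1 : c ≤ frobSq (B * ((1 / 2 : ℝ) • X + (1 / 2 : ℝ) • (A * X))) := by
    rw [← hBmax]
    exact hXmin hmid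
  rw [Matrix.mul_add, Matrix.mul_smul, Matrix.mul_smul, frobSq_midpoint, ← Matrix.mul_assoc] at h1
  have h2 := hle B hB
  have h3 := hle _ (hmul B hB A hA)
  have h4 := frobSq_nonneg (B * X - B * A * X)
  have h5 : B * X - B * (A * X) = 0 := by
    rw [← Matrix.mul_assoc]
    exact eq_zero_of_frobSq_eq_zero (by linarith)
  have hu : IsUnit B := (Matrix.isUnit_iff_isUnit_det B).mpr (hdet B hB).isUnit
  exact (hu.mul_left_cancel (sub_eq_zero.mp h5)).symm

theorem isCompact_setOf_norm_det_eq_one [Nonempty m] {T : Set (Matrix m m ℂ)} (hT : IsClosed T)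
    (hsmul : ∀ t : ℝ, 0 < t → ∀ M ∈ T, t • M ∈ T) (hdet : ∀ M ∈ T, M ≠ 0 → M.det ≠ 0) :
    IsCompact {M | M ∈ T ∧ ‖M.det‖ = 1} := by
  have hcd : Continuous fun M : Matrix m m ℂ => ‖M.det‖ := continuous_id.matrix_det.norm
  refine Metric.isCompact_of_isClosed_isBounded
    (hT.inter (isClosed_eq hcd continuous_const)) ?_
  have hcpt : IsCompact (T ∩ Metric.sphere (0 : Matrix m m ℂ) 1) :=
    (isCompact_sphere _ _).inter_left hT
  have hunit : ∀ M ∈ T, ‖M.det‖ = 1 → M ≠ 0 ∧ ‖M‖⁻¹ • M ∈ T ∩ Metric.sphere 0 1 := by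
    intro M hM hM1
    have hM0 : M ≠ 0 := by
      rintro rfl
      simp [det_zero] at hM1
    refine ⟨hM0, hsmul _ (inv_pos.mpr (norm_pos_iff.mpr hM0)) _ hM, ?_⟩
    simp [norm_smul, hM0]
  rcases (T ∩ Metric.sphere (0 : Matrix m m ℂ) 1).eq_empty_or_nonempty with h | h
  · convert Bornology.isBounded_empty
    refine Set.eq_empty_of_forall_notMem fun M hM => ?_
    have := (hunit M hM.1 hM.2).2
    rw [h] at this
    exact this
  obtain ⟨M₀, hM₀, hmin⟩ := hcpt.exists_isMinOn h hcd.continuousOn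
  have hδ : 0 < ‖M₀.det‖ := by
    refine norm_pos_iff.mpr (hdet _ hM₀.1 ?_)
    rintro rfl
    simpa using hM₀.2
  refine (Metric.isBounded_closedBall (x := (0 : Matrix m m ℂ))
    (r := max 1 ‖M₀.det‖⁻¹)).subset fun M hM => ?_
  rw [mem_closedBall_zero_iff]
  obtain ⟨hM0, hM1⟩ := hunit M hM.1 hM.2
  have hpos := norm_pos_iff.mpr hM0
  have h1 : ‖M₀.det‖ ≤ ‖(‖M‖⁻¹ • M).det‖ := hmin hM1
  have h2 : (‖M‖⁻¹ • M).det = ((‖M‖⁻¹ : ℝ) : ℂ) ^ Fintype.card m * M.det := by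
    rw [← det_smul]
    congr 1
  rw [h2, norm_mul, hM.2, mul_one, norm_pow, Complex.norm_real, norm_inv, norm_norm, inv_pow] at h1
  rcases le_total ‖M‖ 1 with h3 | h3
  · exact le_max_of_le_left h3
  · refine le_max_of_le_right ((le_self_pow₀ h3 (Fintype.card_ne_zero (α := m))).trans ?_)
    exact (le_inv_comm₀ hδ (by positivity)).mp h1

theorem exists_common_eigenvector [Nonempty m] {T : Set (Matrix m m ℂ)} (hT : IsClosed T)
    (hmul : ∀ A ∈ T, ∀ B ∈ T, A * B ∈ T) (hsmul : ∀ t : ℝ, 0 < t → ∀ M ∈ T, t • M ∈ T)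
    (hdet : ∀ M ∈ T, M ≠ 0 → M.det ≠ 0) (htr : ∀ M ∈ T, 0 ≤ (trace M).re)
    (hne : ∃ M ∈ T, M ≠ 0) :
    1 ∈ T ∧ ∃ w : m → ℂ, w ≠ 0 ∧ ∀ M ∈ T, ∃ c : ℂ, M *ᵥ w = c • w := by
  have hK := isCompact_setOf_norm_det_eq_one hT hsmul hdet
  set K := {M | M ∈ T ∧ ‖M.det‖ = 1} with hKdef
  have hKmul : ∀ A ∈ K, ∀ B ∈ K, A * B ∈ K := fun A hA B hB =>
    ⟨hmul _ hA.1 _ hB.1, by rw [det_mul, norm_mul, hA.2, hB.2, one_mul]⟩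
  have hKdet : ∀ A ∈ K, A.det ≠ 0 := fun A hA => norm_ne_zero_iff.mp (by simp [hA.2])
  have hscale : ∀ M ∈ T, M ≠ 0 → ∃ t : ℝ, 0 < t ∧ t • M ∈ K := by
    intro M hM hM0
    have hpos := norm_pos_iff.mpr (hdet M hM hM0)
    set t := ‖M.det‖⁻¹ ^ (Fintype.card m : ℝ)⁻¹ with ht
    have ht0 : 0 < t := Real.rpow_pos_of_pos (inv_pos.mpr hpos) _
    refine ⟨t, ht0, hsmul t ht0 M hM, ?_⟩
    have h2 : (t • M).det = (t : ℂ) ^ Fintype.card m * M.det := by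
      rw [← det_smul]
      congr 1
    rw [h2, norm_mul, norm_pow, Complex.norm_real, Real.norm_of_nonneg ht0.le, ht,
      Real.rpow_inv_natCast_pow (inv_pos.mpr hpos).le Fintype.card_ne_zero,
      inv_mul_cancel₀ hpos.ne']
  obtain ⟨M₀, hM₀, hM₀0⟩ := hne
  obtain ⟨t, -, htK⟩ := hscale M₀ hM₀ hM₀0
  obtain ⟨B, hB, hB1⟩ := exists_left_inverse_of_isCompact_semigroup hK hKmul hKdet htK
  obtain ⟨X, hX0, hX⟩ := exists_fixed_matrix_of_isCompact_semigroup hK ⟨_, htK⟩ hKmul hKdet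
    fun A hA => htr A hA.1
  refine ⟨hB1 ▸ hmul _ hB.1 _ htK.1, ?_⟩
  obtain ⟨j, hj⟩ : ∃ j, X.col j ≠ 0 := by
    by_contra! h
    exact hX0 (by ext i j; exact congrFun (h j) i)
  refine ⟨X.col j, hj, fun M hM => ?_⟩
  by_cases hM0 : M = 0
  · exact ⟨0, by simp [hM0]⟩
  obtain ⟨u, hu0, hu⟩ := hscale M hM hM0
  refine ⟨((u⁻¹ : ℝ) : ℂ), ?_⟩
  have h1 : (u • M) *ᵥ X.col j = X.col j := by
    ext i
    exact congrFun (congrFun (hX _ hu) i) j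
  calc M *ᵥ X.col j = ((u⁻¹ * u) • M) *ᵥ X.col j := by rw [inv_mul_cancel₀ hu0.ne', one_smul]
    _ = u⁻¹ • ((u • M) *ᵥ X.col j) := by rw [mul_smul, smul_mulVec]
    _ = _ := by rw [h1, Complex.coe_smul]

end CompactSemigroups

section RankOne

variable {m : Type*} [Fintype m]

theorem exists_mul_mul_ne_zero {S : Set (Matrix m m ℂ)}
    (hsep : ∀ y x : m → ℂ, y ≠ 0 → x ≠ 0 → ∃ A ∈ S, y ⬝ᵥ A *ᵥ x ≠ 0)
    {l l' : Type*} {A : Matrix l m ℂ} {C : Matrix m l' ℂ} (hA : A ≠ 0) (hC : C ≠ 0) :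
    ∃ B ∈ S, A * B * C ≠ 0 := by
  obtain ⟨i, hi⟩ : ∃ i, A i ≠ 0 := Function.ne_iff.mp hA
  obtain ⟨k, j, hkj⟩ : ∃ k j, C k j ≠ 0 := by
    by_contra! h
    exact hC (by ext k j; exact h k j)
  obtain ⟨B, hB, hne⟩ := hsep (A i) (C.col j) hi (Function.ne_iff.mpr ⟨k, hkj⟩)
  refine ⟨B, hB, fun h => hne ?_⟩
  rw [dotProduct_mulVec]
  exact congrFun (congrFun h i) j

variable [DecidableEq m]

theorem exists_rank_factorization (A : Matrix m m ℂ) :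
    ∃ (X : Matrix m (Fin A.rank) ℂ) (Y : Matrix (Fin A.rank) m ℂ), A = X * Y := by
  let b : Module.Basis (Fin A.rank) ℂ (LinearMap.range A.mulVecLin) :=
    Module.finBasisOfFinrankEq _ _ rfl
  refine ⟨of fun i k => (b k : m → ℂ) i,
    of fun k j => b.repr ⟨A *ᵥ Pi.single j 1, Pi.single j 1, rfl⟩ k, ?_⟩
  ext i j
  have h := congrArg (fun z : LinearMap.range A.mulVecLin => (z : m → ℂ) i)
    (b.sum_repr ⟨A *ᵥ Pi.single j 1, Pi.single j 1, rfl⟩)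
  simp only [AddSubmonoidClass.coe_finsetSum, Finset.sum_apply, SetLike.val_smul, Pi.smul_apply,
    smul_eq_mul, mulVec_single_one, col_apply] at h
  rw [← h, mul_apply]
  refine Finset.sum_congr rfl fun k _ => ?_
  simp [mul_comm]

theorem det_ne_zero_of_card_le_rank {A : Matrix m m ℂ} (h : Fintype.card m ≤ A.rank) :
    A.det ≠ 0 := by
  have htop : LinearMap.range A.mulVecLin = ⊤ := by
    refine Submodule.eq_top_of_finrank_eq (le_antisymm (Submodule.finrank_le _) ?_)
    rwa [Module.finrank_fintype_fun_eq_card]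
  have hs : Function.Surjective A.mulVec := LinearMap.range_eq_top.mp htop
  exact ((isUnit_iff_isUnit_det A).mp (mulVec_surjective_iff_isUnit.mp hs)).ne_zero

/-- A closed irreducible semigroup with nonnegative traces contains a rank-one idempotent. -/
theorem exists_vecMulVec_mem [Nonempty m] {S : Set (Matrix m m ℂ)} (hS : IsClosed S)
    (hone : 1 ∈ S) (hmul : ∀ A ∈ S, ∀ B ∈ S, A * B ∈ S)
    (hsmul : ∀ t : ℝ, 0 < t → ∀ A ∈ S, t • A ∈ S) (htr : ∀ A ∈ S, 0 ≤ (trace A).re)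
    (hsep : ∀ y x : m → ℂ, y ≠ 0 → x ≠ 0 → ∃ A ∈ S, y ⬝ᵥ A *ᵥ x ≠ 0) :
    ∃ u v : m → ℂ, v ⬝ᵥ u = 1 ∧ vecMulVec u v ∈ S := by
  obtain ⟨A, ⟨hAS, hA0⟩, hAmin⟩ : ∃ A, (A ∈ S ∧ A ≠ 0) ∧
      ∀ B, B ∈ S ∧ B ≠ 0 → A.rank ≤ B.rank := by
    have hne : {A | A ∈ S ∧ A ≠ 0}.Nonempty := ⟨1, hone, one_ne_zero⟩
    refine ⟨Function.argminOn rank _ hne, Function.argminOn_mem rank _ hne, fun B hB => ?_⟩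
    exact Function.argminOn_le rank _ hB
  obtain ⟨B, hBS, hABA⟩ := exists_mul_mul_ne_zero hsep hA0 hA0
  have hAfac := exists_rank_factorization A
  have hABArank := hAmin _ ⟨hmul _ (hmul _ hAS _ hBS) _ hAS, hABA⟩
  generalize A.rank = r at hAfac hABArank hAmin
  obtain ⟨X, Y₀, rfl⟩ := hAfac
  obtain ⟨D, hD⟩ : ∃ D, D = Y₀ * B * X := ⟨_, rfl⟩
  have hDdet : D.det ≠ 0 := by
    refine det_ne_zero_of_card_le_rank ?_
    rw [Fintype.card_fin]
    refine hABArank.trans ?_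
    have : X * Y₀ * B * (X * Y₀) = X * D * Y₀ := by simp only [hD, Matrix.mul_assoc]
    rw [this]
    exact (rank_mul_le_left _ _).trans (rank_mul_le_right _ _)
  have hDu : IsUnit D.det := hDdet.isUnit
  obtain ⟨Y, hY⟩ : ∃ Y, Y = D⁻¹ * Y₀ * B := ⟨_, rfl⟩
  have hYX : Y * X = 1 := by
    rw [hY, Matrix.mul_assoc, Matrix.mul_assoc, ← Matrix.mul_assoc Y₀, ← hD, nonsing_inv_mul _ hDu]
  have hr : Nonempty (Fin r) := by
    by_contra h
    rw [not_nonempty_iff] at h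
    exact hA0 (by ext i j; simp [mul_apply])
  have hfac : ∀ M : Matrix (Fin r) (Fin r) ℂ, Y * (X * M * Y) * X = M := fun M => by
    rw [Matrix.mul_assoc X, ← Matrix.mul_assoc Y, hYX, Matrix.one_mul, Matrix.mul_assoc, hYX,
      Matrix.mul_one]
  obtain ⟨h1, w, hw0, hw⟩ := exists_common_eigenvector (T := {M : Matrix (Fin r) (Fin r) ℂ | X * M * Y ∈ S})
    (hS.preimage ((continuous_const.matrix_mul continuous_id).matrix_mul continuous_const))
    (fun M hM M' hM' => by
      have : X * (M * M') * Y = X * M * Y * (X * M' * Y) := by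
        calc X * (M * M') * Y = X * M * (1 * M') * Y := by simp only [Matrix.mul_assoc,
              Matrix.one_mul]
          _ = _ := by rw [← hYX]; simp only [Matrix.mul_assoc]
      rw [Set.mem_ofPred_eq, this]
      exact hmul _ hM _ hM')
    (fun t ht M hM => by
      rw [Set.mem_ofPred_eq, Matrix.mul_smul, Matrix.smul_mul]
      exact hsmul t ht _ hM)
    (fun M hM hM0 => by
      refine det_ne_zero_of_card_le_rank ?_
      rw [Fintype.card_fin]
      refine (hAmin _ ⟨hM, fun h => hM0 ?_⟩).trans
        ((rank_mul_le_left _ _).trans (rank_mul_le_right _ _))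
      rw [← hfac M, h, Matrix.mul_zero, Matrix.zero_mul])
    (fun M hM => by
      have := htr _ hM
      rwa [Matrix.trace_mul_comm, ← Matrix.mul_assoc, hYX, Matrix.one_mul] at this)
    ⟨D, by
      have : X * D * Y = X * Y₀ * B := by
        rw [hY, Matrix.mul_assoc, Matrix.mul_assoc D⁻¹, mul_nonsing_inv_cancel_left _ _ hDu,
          Matrix.mul_assoc]
      rw [Set.mem_ofPred_eq, this]
      exact hmul _ hAS _ hBS, fun h => hDdet (by rw [h, det_zero])⟩
  rw [Set.mem_ofPred_eq, Matrix.mul_one] at h1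
  have hperp : ∀ z : Fin r → ℂ, z ⬝ᵥ w = 0 → z = 0 := by
    intro z hzw
    by_contra hz
    have hzY : z ᵥ* Y ≠ 0 := fun h => hz (by
      rw [← vecMul_one z, ← hYX, ← vecMul_vecMul, h, zero_vecMul])
    have hXw : X *ᵥ w ≠ 0 := fun h => hw0 (by
      rw [← one_mulVec w, ← hYX, ← mulVec_mulVec, h, mulVec_zero])
    obtain ⟨C, hC, hne⟩ := hsep _ _ hzY hXw
    obtain ⟨c, hc⟩ := hw (Y * C * X) (by
      have : X * (Y * C * X) * Y = X * Y * C * (X * Y) := by simp only [Matrix.mul_assoc]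
      rw [Set.mem_ofPred_eq, this]
      exact hmul _ (hmul _ h1 _ hC) _ h1)
    apply hne
    rw [← dotProduct_mulVec, mulVec_mulVec, mulVec_mulVec, hc,
      dotProduct_smul, hzw, smul_zero]
  obtain ⟨k, hk⟩ := Function.ne_iff.mp hw0
  have huniq : ∀ k', k' = k := by
    intro k'
    by_contra hne
    have := congrFun (hperp (Pi.single k' (w k) - Pi.single k (w k')) (by
      rw [sub_dotProduct, single_dotProduct, single_dotProduct]; ring)) k'
    simp [hne] at this
    exact hk this
  let _ : Unique (Fin r) := ⟨⟨k⟩, huniq⟩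
  refine ⟨X.col default, Y default, ?_, ?_⟩
  · exact (congrFun (congrFun hYX default) default).trans (one_apply_eq _)
  · convert h1
    ext i j
    simp [mul_apply, vecMulVec_apply]

end RankOne

section Orbits

open Filter Topology
open scoped ComplexOrder

variable {m : Type*} [Fintype m]

/-- A pair of sets of vectors, invariant under the right resp. left action of a group `G` of
matrices, whose rank-one products lie in the closure of `G` and have nonnegative diagonals. -/
structure IsOrbitPair (G : Set (Matrix m m ℂ)) (U V : Set (m → ℂ)) : Prop where
  ne_zero_left : ∀ x ∈ U, x ≠ 0
  ne_zero_right : ∀ y ∈ V, y ≠ 0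
  nonempty_left : U.Nonempty
  nonempty_right : V.Nonempty
  mem_closure : ∀ x ∈ U, ∀ y ∈ V, vecMulVec x y ∈ closure G
  nonneg : ∀ x ∈ U, ∀ y ∈ V, ∀ i, 0 ≤ x i * y i
  mulVec_mem : ∀ A ∈ G, ∀ x ∈ U, A *ᵥ x ∈ U
  vecMul_mem : ∀ A ∈ G, ∀ y ∈ V, y ᵥ* A ∈ V
  smul_mem : ∀ t : ℝ, 0 < t → ∀ x ∈ U, t • x ∈ U
  mem_of_mem_closure : ∀ x ∈ closure U, x ≠ 0 → x ∈ U

/-- The members of `V` annihilating `x`. -/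
def annih (V : Set (m → ℂ)) (x : m → ℂ) : Set (m → ℂ) := {y | y ∈ V ∧ y ⬝ᵥ x = 0}

/-- The members of `U` whose annihilator in `V` is maximal. -/
def extremal (U V : Set (m → ℂ)) : Set (m → ℂ) :=
  {x | x ∈ U ∧ ∀ x' ∈ U, annih V x ⊆ annih V x' → annih V x' ⊆ annih V x}

namespace IsOrbitPair

variable {G : Set (Matrix m m ℂ)} {U V : Set (m → ℂ)}

theorem dotProduct_eq_zero_iff (h : IsOrbitPair G U V) {x y : m → ℂ} (hx : x ∈ U)
    (hy : y ∈ V) : y ⬝ᵥ x = 0 ↔ ∀ i, x i ≠ 0 → y i = 0 := by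
  rw [dotProduct, Finset.sum_eq_zero_iff_of_nonneg
    fun i _ => (mul_comm (x i) (y i)) ▸ h.nonneg x hx y hy i]
  refine ⟨fun H i hi => (mul_eq_zero.mp (H i (Finset.mem_univ i))).resolve_right hi,
    fun H i _ => ?_⟩
  by_cases hi : x i = 0
  · rw [hi, mul_zero]
  · rw [H i hi, zero_mul]

theorem annih_subset (h : IsOrbitPair G U V) {x x' : m → ℂ} (hx : x ∈ U) (hx' : x' ∈ U)
    (H : ∀ i, x i ≠ 0 → x' i ≠ 0) : annih V x' ⊆ annih V x := fun _ hy =>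
  ⟨hy.1, (h.dotProduct_eq_zero_iff hx hy.1).mpr fun i hi =>
    (h.dotProduct_eq_zero_iff hx' hy.1).mp hy.2 i (H i hi)⟩

theorem extremal_nonempty (h : IsOrbitPair G U V) : (extremal U V).Nonempty := by
  have hfin : (annih V '' U).Finite := by
    refine (Set.finite_range fun s : Set m => {y | y ∈ V ∧ ∀ i ∈ s, y i = 0}).subset ?_
    rintro _ ⟨x, hx, rfl⟩
    refine ⟨{i | x i ≠ 0}, ?_⟩
    ext y
    exact and_congr_right fun hy => (h.dotProduct_eq_zero_iff hx hy).symm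
  obtain ⟨_, ⟨x, hx, rfl⟩, hmax⟩ := hfin.exists_maximal (h.nonempty_left.image _)
  exact ⟨x, hx, fun x' hx' hle => hmax (Set.mem_image_of_mem _ hx') hle⟩

theorem annih_mulVec_subset_iff (h : IsOrbitPair G U V) {A B : Matrix m m ℂ} (hA : A ∈ G)
    (hB : B ∈ G) [DecidableEq m] (hAB : A * B = 1) (x x' : m → ℂ) :
    annih V (A *ᵥ x) ⊆ annih V x' ↔ annih V x ⊆ annih V (B *ᵥ x') := by
  have hBA : B * A = 1 := mul_eq_one_comm.mp hAB
  constructor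
  · intro H y hy
    have : y ᵥ* B ∈ annih V x' := H ⟨h.vecMul_mem B hB y hy.1, by
      rw [dotProduct_mulVec, vecMul_vecMul, hBA, vecMul_one, hy.2]⟩
    exact ⟨hy.1, by rw [dotProduct_mulVec, this.2]⟩
  · intro H y hy
    have : y ᵥ* A ∈ annih V (B *ᵥ x') := H ⟨h.vecMul_mem A hA y hy.1, by
      rw [← dotProduct_mulVec, hy.2]⟩
    have h2 := this.2
    rw [dotProduct_mulVec, vecMul_vecMul, hAB, vecMul_one] at h2
    exact ⟨hy.1, h2⟩

variable [DecidableEq m]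

theorem mulVec_mem_extremal (h : IsOrbitPair G U V) {A B : Matrix m m ℂ} (hA : A ∈ G)
    (hB : B ∈ G) (hAB : A * B = 1) {x : m → ℂ} (hx : x ∈ extremal U V) :
    A *ᵥ x ∈ extremal U V := by
  refine ⟨h.mulVec_mem A hA x hx.1, fun x' hx' H => ?_⟩
  have h1 := hx.2 _ (h.mulVec_mem B hB x' hx') ((h.annih_mulVec_subset_iff hA hB hAB x x').mp H)
  rw [h.annih_mulVec_subset_iff hB hA (mul_eq_one_comm.mp hAB)] at h1
  exact h1

theorem eventually_annih_mulVec_eq (h : IsOrbitPair G U V)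
    (hinv : ∀ A ∈ G, ∃ B ∈ G, A * B = 1) {x x' y : m → ℂ} (hx : x ∈ extremal U V)
    (hx' : x' ∈ extremal U V) (hyx' : y ⬝ᵥ x' ≠ 0) :
    ∀ᶠ A in 𝓝 (vecMulVec x y), A ∈ G → annih V (A *ᵥ x') = annih V x := by
  have hsupp : ∀ᶠ A in 𝓝 (vecMulVec x y), ∀ i, x i ≠ 0 → (A *ᵥ x') i ≠ 0 := by
    refine eventually_all.mpr fun i => ?_
    by_cases hi : x i = 0
    · exact Eventually.of_forall fun A hA => absurd hi hA
    have hc : Continuous fun A : Matrix m m ℂ => (A *ᵥ x') i :=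
      (continuous_apply i).comp (continuous_id.matrix_mulVec continuous_const)
    have hne : (vecMulVec x y *ᵥ x') i ≠ 0 := by
      rw [vecMulVec_mulVec]
      exact mul_ne_zero hi hyx'
    filter_upwards [hc.continuousAt.eventually_ne hne] with A hA _ using hA
  filter_upwards [hsupp] with A hA hAG
  obtain ⟨B, hB, hAB⟩ := hinv A hAG
  have hAx := h.mulVec_mem_extremal hAG hB hAB hx'
  have h1 := h.annih_subset hx.1 hAx.1 hA
  exact h1.antisymm (hAx.2 x hx.1 h1)

theorem exists_eq_smul (h : IsOrbitPair G U V) (hinv : ∀ A ∈ G, ∃ B ∈ G, A * B = 1)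
    {x x' y : m → ℂ} (hx : x ∈ extremal U V) (hx' : x' ∈ extremal U V) (hy : y ∈ V)
    (hyx : y ⬝ᵥ x ≠ 0) (hyx' : y ⬝ᵥ x' ≠ 0) : ∃ c : ℂ, x = c • x' := by
  have : FirstCountableTopology (Matrix m m ℂ) :=
    inferInstanceAs (FirstCountableTopology (m → m → ℂ))
  obtain ⟨a, haG, ha⟩ := mem_closure_iff_seq_limit.mp (h.mem_closure x hx.1 y hy)
  obtain ⟨N, hN⟩ := eventually_atTop.mp
    ((ha.eventually (h.eventually_annih_mulVec_eq hinv hx hx hyx)).and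
      (ha.eventually (h.eventually_annih_mulVec_eq hinv hx hx' hyx')))
  choose b hbG hab using fun k => hinv (a k) (haG k)
  have hba : ∀ k, b k * a k = 1 := fun k => mul_eq_one_comm.mp (hab k)
  have hxx' : annih V x' = annih V x := by
    have h1 := (hN N le_rfl).1 (haG N)
    have h2 := (hN N le_rfl).2 (haG N)
    have h3 := h1.trans h2.symm
    apply Set.Subset.antisymm
    · have := (h.annih_mulVec_subset_iff (haG N) (hbG N) (hab N) x' (a N *ᵥ x)).mp h3.symm.subset
      rwa [mulVec_mulVec, hba, one_mulVec] at this
    · have := (h.annih_mulVec_subset_iff (haG N) (hbG N) (hab N) x (a N *ᵥ x')).mp h3.subset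
      rwa [mulVec_mulVec, hba, one_mulVec] at this
  have hbx : ∀ k, N ≤ k → annih V x ⊆ annih V (b k *ᵥ x') := fun k hk => by
    rw [← h.annih_mulVec_subset_iff (haG k) (hbG k) (hab k), (hN k hk).1 (haG k), hxx']
  set z : ℕ → m → ℂ := fun k => ‖b k *ᵥ x'‖⁻¹ • (b k *ᵥ x') with hz
  have hbU : ∀ k, b k *ᵥ x' ∈ U := fun k => h.mulVec_mem _ (hbG k) _ hx'.1
  have hpos : ∀ k, 0 < ‖b k *ᵥ x'‖ := fun k => norm_pos_iff.mpr (h.ne_zero_left _ (hbU k))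
  have hzU : ∀ k, z k ∈ U := fun k => h.smul_mem _ (inv_pos.mpr (hpos k)) _ (hbU k)
  have hzs : ∀ k, z k ∈ Metric.sphere (0 : m → ℂ) 1 := fun k => by
    rw [mem_sphere_zero_iff_norm, hz, norm_smul, norm_inv, norm_norm, inv_mul_cancel₀ (hpos k).ne']
  obtain ⟨z₀, hz₀s, φ, hφ, hlim⟩ := (isCompact_sphere (0 : m → ℂ) 1).tendsto_subseq hzs
  have hz₀U : z₀ ∈ U := by
    refine h.mem_of_mem_closure _ (mem_closure_of_tendsto hlim
      (Eventually.of_forall fun k => hzU _)) ?_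
    rintro rfl
    simp at hz₀s
  have hxz : annih V x ⊆ annih V z₀ := by
    intro y' hy'
    refine ⟨hy'.1, ?_⟩
    have hc : Continuous fun w : m → ℂ => y' ⬝ᵥ w := continuous_const.dotProduct continuous_id
    refine tendsto_nhds_unique ((hc.tendsto z₀).comp hlim) (tendsto_const_nhds.congr' ?_)
    filter_upwards [eventually_ge_atTop N] with k hk
    have := (hbx (φ k) (hk.trans (hφ.id_le k)) hy').2
    simp [hz, dotProduct_smul, this]
  have hyz : y ⬝ᵥ z₀ ≠ 0 := fun H => hyx (hx.2 z₀ hz₀U hxz ⟨hy, H⟩).2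
  have hspan : vecMulVec x y *ᵥ z₀ ∈ Submodule.span ℂ {x'} := by
    have hcl : IsClosed (Submodule.span ℂ {x'} : Set (m → ℂ)) :=
      Submodule.closed_of_finiteDimensional _
    have hc : Continuous fun p : Matrix m m ℂ × (m → ℂ) => p.1 *ᵥ p.2 :=
      continuous_fst.matrix_mulVec continuous_snd
    refine hcl.mem_of_tendsto ((hc.tendsto (vecMulVec x y, z₀)).comp
      ((ha.comp hφ.tendsto_atTop).prodMk_nhds hlim)) (Eventually.of_forall fun k => ?_)
    simp only [Function.comp, hz, mulVec_smul, mulVec_mulVec, hab, one_mulVec]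
    rw [← Complex.coe_smul]
    exact Submodule.smul_mem _ _ (Submodule.mem_span_singleton_self x')
  obtain ⟨c, hc⟩ := Submodule.mem_span_singleton.mp hspan
  rw [vecMulVec_mulVec, op_smul_eq_smul] at hc
  refine ⟨(y ⬝ᵥ z₀)⁻¹ * c, ?_⟩
  rw [mul_smul, hc, inv_smul_smul₀ hyz]

theorem exists_monomial_basis (h : IsOrbitPair G U V)
    (hinv : ∀ A ∈ G, ∃ B ∈ G, A * B = 1)
    (hsep : ∀ y x : m → ℂ, y ≠ 0 → x ≠ 0 → ∃ A ∈ G, y ⬝ᵥ A *ᵥ x ≠ 0) :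
    ∃ l : m → ℂ, (∀ i, l i ≠ 0) ∧ ∀ A ∈ G, ∀ i, ∃ j, ∃ t : ℝ, 0 < t ∧
      A *ᵥ Pi.single i (l i) = Pi.single j (t * l j) := by
  obtain ⟨x₀, hx₀⟩ := h.extremal_nonempty
  obtain ⟨y₀, hy₀⟩ := h.nonempty_right
  have hex : ∀ i, ∃ x ∈ extremal U V, x i ≠ 0 := fun i => by
    obtain ⟨A, hA, hne⟩ := hsep (Pi.single i 1) x₀ (by simp) (h.ne_zero_left _ hx₀.1)
    obtain ⟨B, hB, hAB⟩ := hinv A hA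
    exact ⟨_, h.mulVec_mem_extremal hA hB hAB hx₀, by simpa using hne⟩
  have hey : ∀ i, ∃ y ∈ V, y i ≠ 0 := fun i => by
    obtain ⟨A, hA, hne⟩ := hsep y₀ (Pi.single i 1) (h.ne_zero_right _ hy₀) (by simp)
    rw [dotProduct_mulVec, dotProduct_single, mul_one] at hne
    exact ⟨_, h.vecMul_mem A hA _ hy₀, hne⟩
  choose X hX hXi using hex
  choose Y hY hYi using hey
  have hdot : ∀ {i x}, x ∈ U → x i ≠ 0 → Y i ⬝ᵥ x ≠ 0 := fun {i x} hx hi H =>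
    hYi i ((h.dotProduct_eq_zero_iff hx (hY i)).mp H i hi)
  have hprop : ∀ x ∈ extremal U V, ∀ i, x i ≠ 0 → ∃ c : ℂ, x = c • X i := fun x hx i hi =>
    h.exists_eq_smul hinv hx (hX i) (hY i) (hdot hx.1 hi) (hdot (hX i).1 (hXi i))
  have hunit : IsUnit (of X) := by
    refine mulVec_injective_iff_isUnit.mp
      ((injective_iff_map_eq_zero (mulVecLin (of X)).toAddMonoidHom).mpr fun y hy => ?_)
    by_contra hy0
    obtain ⟨A, hA, hne⟩ := hsep y x₀ hy0 (h.ne_zero_left _ hx₀.1)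
    obtain ⟨B, hB, hAB⟩ := hinv A hA
    have hAx := h.mulVec_mem_extremal hA hB hAB hx₀
    obtain ⟨i, hi⟩ := Function.ne_iff.mp (h.ne_zero_left _ hAx.1)
    obtain ⟨c, hc⟩ := hprop _ hAx i hi
    apply hne
    have : X i ⬝ᵥ y = 0 := congrFun hy i
    rw [hc, dotProduct_smul, dotProduct_comm, this, smul_zero]
  have hsingle : ∀ x ∈ extremal U V, ∀ i j, x i ≠ 0 → x j ≠ 0 → i = j := by
    intro x hx i j hi hj
    by_contra hij
    obtain ⟨c, hc⟩ := hprop x hx i hi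
    obtain ⟨c', hc'⟩ := hprop x hx j hj
    have hc0 : c ≠ 0 := by
      rintro rfl
      exact hi (by rw [hc, zero_smul, Pi.zero_apply])
    have h0 : (Pi.single i c - Pi.single j c') ᵥ* of X = 0 := by
      rw [sub_vecMul, single_vecMul, single_vecMul]
      change c • X i - c' • X j = 0
      rw [← hc, ← hc', sub_self]
    have h1 := vecMul_injective_iff_isUnit.mpr hunit (h0.trans (zero_vecMul _).symm)
    exact hc0 (by simpa [hij] using congrFun h1 i)
  have hXsingle : ∀ i, Pi.single i (X i i) = X i := fun i => by
    ext j
    rcases eq_or_ne j i with rfl | hji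
    · simp
    · rw [Pi.single_eq_of_ne hji]
      by_contra hj
      exact hji (hsingle _ (hX i) j i (Ne.symm hj) (hXi i))
  refine ⟨fun i => X i i, hXi, fun A hA i => ?_⟩
  obtain ⟨B, hB, hAB⟩ := hinv A hA
  have hAx := h.mulVec_mem_extremal hA hB hAB (hX i)
  obtain ⟨j, hj⟩ := Function.ne_iff.mp (h.ne_zero_left _ hAx.1)
  obtain ⟨c, hc⟩ := hprop _ hAx j hj
  have hc0 : c ≠ 0 := by
    rintro rfl
    exact hj (by rw [hc, zero_smul])
  have h1 := h.nonneg _ hAx.1 _ (hY j) j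
  have h2 := h.nonneg _ (hX j).1 _ (hY j) j
  have h3 : X j j * Y j j ≠ 0 := mul_ne_zero (hXi j) (hYi j)
  rw [hc, Pi.smul_apply, smul_eq_mul, mul_assoc] at h1
  obtain ⟨a, ha, hae⟩ : ∃ a : ℝ, 0 ≤ a ∧ (a : ℂ) = X j j * Y j j :=
    RCLike.nonneg_iff_exists_ofReal.mp h2
  obtain ⟨s, hs, hse⟩ : ∃ s : ℝ, 0 ≤ s ∧ (s : ℂ) = c * (X j j * Y j j) :=
    RCLike.nonneg_iff_exists_ofReal.mp h1
  rw [← hae] at h3 hse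
  have hcs : c = ((s / a : ℝ) : ℂ) := by
    rw [Complex.ofReal_div, eq_div_iff h3, ← hse]
  refine ⟨j, s / a, lt_of_le_of_ne (div_nonneg hs ha) fun H => hc0 (by rw [hcs, ← H]; simp), ?_⟩
  rw [hXsingle, hc, ← hcs]
  conv_lhs => rw [← hXsingle j]
  rw [← Pi.single_smul, smul_eq_mul]

end IsOrbitPair

/-- An irreducible group of matrices with nonnegative diagonals, stable under positive scalars,
permutes the rays spanned by suitable multiples of the standard basis vectors. -/
theorem exists_monomial_basis [DecidableEq m] [Nonempty m] {G : Set (Matrix m m ℂ)} (hone : 1 ∈ G)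
    (hmul : ∀ A ∈ G, ∀ B ∈ G, A * B ∈ G) (hinv : ∀ A ∈ G, ∃ B ∈ G, A * B = 1)
    (hsmul : ∀ t : ℝ, 0 < t → ∀ A ∈ G, t • A ∈ G) (hdiag : ∀ A ∈ G, ∀ i, 0 ≤ A i i)
    (hsep : ∀ y x : m → ℂ, y ≠ 0 → x ≠ 0 → ∃ A ∈ G, y ⬝ᵥ A *ᵥ x ≠ 0) :
    ∃ l : m → ℂ, (∀ i, l i ≠ 0) ∧ ∀ A ∈ G, ∀ i, ∃ j, ∃ t : ℝ, 0 < t ∧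
      A *ᵥ Pi.single i (l i) = Pi.single j (t * l j) := by
  have hSmul : ∀ A ∈ closure G, ∀ B ∈ closure G, A * B ∈ closure G := fun A hA B hB =>
    map_mem_closure₂ (continuous_fst.matrix_mul continuous_snd) hA hB hmul
  have hSsmul : ∀ t : ℝ, 0 < t → ∀ A ∈ closure G, t • A ∈ closure G := fun t ht A hA =>
    map_mem_closure (continuous_const_smul t) hA (hsmul t ht)
  have hSdiag : ∀ A ∈ closure G, ∀ i, 0 ≤ A i i := fun A hA i =>
    closure_minimal (fun A hA => hdiag A hA i)
      (isClosed_Ici.preimage (continuous_id.matrix_elem i i)) hA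
  have hGS : G ⊆ closure G := subset_closure
  obtain ⟨u, v, huv, hE⟩ := exists_vecMulVec_mem (S := closure G) isClosed_closure (hGS hone)
    hSmul hSsmul
    (fun A hA => (Complex.nonneg_iff.mp (Finset.sum_nonneg fun i _ => hSdiag A hA i)).1)
    (fun y x hy hx => by
      obtain ⟨A, hA, h⟩ := hsep y x hy hx
      exact ⟨A, hGS hA, h⟩)
  have hu : u ≠ 0 := by rintro rfl; simp at huv
  have hv : v ≠ 0 := by rintro rfl; simp at huv
  have hUV : ∀ x y, vecMulVec x v ∈ closure G → vecMulVec u y ∈ closure G →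
      vecMulVec x y ∈ closure G := fun x y hx hy => by
    have := hSmul _ hx _ hy
    rwa [vecMulVec_mul_vecMulVec, huv, one_smul] at this
  refine IsOrbitPair.exists_monomial_basis (U := {x | x ≠ 0 ∧ vecMulVec x v ∈ closure G})
    (V := {y | y ≠ 0 ∧ vecMulVec u y ∈ closure G}) (G := G)
    ⟨fun x hx => hx.1, fun y hy => hy.1, ⟨u, hu, hE⟩, ⟨v, hv, hE⟩,
      fun x hx y hy => hUV x y hx.2 hy.2, fun x hx y hy i => ?_, fun A hA x hx => ⟨fun H => ?_, ?_⟩,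
      fun A hA y hy => ⟨fun H => ?_, ?_⟩, fun t ht x hx => ⟨smul_ne_zero ht.ne' hx.1, ?_⟩,
      fun x hx hx0 => ⟨hx0, ?_⟩⟩ hinv hsep
  · exact hSdiag _ (hUV x y hx.2 hy.2) i
  · obtain ⟨B, -, hAB⟩ := hinv A hA
    exact hx.1 (by
      rw [← one_mulVec x, ← mul_eq_one_comm.mp hAB, ← mulVec_mulVec, H, mulVec_zero])
  · rw [← mul_vecMulVec]
    exact hSmul _ (hGS hA) _ hx.2
  · obtain ⟨B, -, hAB⟩ := hinv A hA
    exact hy.1 (by rw [← vecMul_one y, ← hAB, ← vecMul_vecMul, H, zero_vecMul])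
  · rw [← vecMulVec_mul]
    exact hSmul _ hy.2 _ (hGS hA)
  · rw [smul_vecMulVec]
    exact hSsmul t ht _ hx.2
  · have hc : Continuous fun x : m → ℂ => vecMulVec x v :=
      continuous_id.matrix_vecMulVec continuous_const
    exact closure_minimal (fun x hx => hx.2) (isClosed_closure.preimage hc) hx

end Orbits

/-- An irreducible group of complex matrices with nonnegative diagonals is
diagonally similar to a group of nonnegative monomial matrices: after conjugation by a single
invertible diagonal matrix, every member has nonnegative real entries and has exactly one
nonzero entry in each row and in each column (which is then a positive real number). -/
theorem stmt_2 {n : ℕ} (hn : 2 ≤ n) (G : Set (Matrix (Fin n) (Fin n) ℂ))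
    (hunit : ∀ A ∈ G, IsUnit A)
    (hmul : ∀ A ∈ G, ∀ B ∈ G, A * B ∈ G)
    (hone : (1 : Matrix (Fin n) (Fin n) ℂ) ∈ G)
    (hinv : ∀ A ∈ G, A⁻¹ ∈ G)
    (hirr : ∀ p : Submodule ℂ (Fin n → ℂ),
      (∀ A ∈ G, ∀ v ∈ p, A.mulVec v ∈ p) → p = ⊥ ∨ p = ⊤)
    (hdiag : ∀ A ∈ G, ∀ i, 0 ≤ (A i i).re ∧ (A i i).im = 0) :
    ∃ d : Fin n → ℂ, (∀ i, d i ≠ 0) ∧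
      ∀ A ∈ G,
        (∀ i j, 0 ≤ ((diagonal d * A * diagonal (fun i => (d i)⁻¹)) i j).re ∧
          ((diagonal d * A * diagonal (fun i => (d i)⁻¹)) i j).im = 0) ∧
        (∀ i, ∃! j, (diagonal d * A * diagonal (fun i => (d i)⁻¹)) i j ≠ 0) ∧
        (∀ j, ∃! i, (diagonal d * A * diagonal (fun i => (d i)⁻¹)) i j ≠ 0) ∧
        (∀ i j, (diagonal d * A * diagonal (fun i => (d i)⁻¹)) i j ≠ 0 →
          0 < ((diagonal d * A * diagonal (fun i => (d i)⁻¹)) i j).re) := by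
  have : Nonempty (Fin n) := ⟨⟨0, by omega⟩⟩
  obtain ⟨l, hl, hG⟩ := exists_monomial_basis
    (G := {A : Matrix (Fin n) (Fin n) ℂ | ∃ t : ℝ, 0 < t ∧ ∃ B ∈ G, A = t • B})
    ⟨1, one_pos, 1, hone, (one_smul _ _).symm⟩
    (by
      rintro _ ⟨s, hs, A, hA, rfl⟩ _ ⟨t, ht, B, hB, rfl⟩
      exact ⟨s * t, mul_pos hs ht, A * B, hmul A hA B hB, smul_mul_smul_comm s A t B⟩)
    (by
      rintro _ ⟨t, ht, A, hA, rfl⟩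
      refine ⟨t⁻¹ • A⁻¹, ⟨t⁻¹, inv_pos.mpr ht, A⁻¹, hinv A hA, rfl⟩, ?_⟩
      rw [smul_mul_smul_comm, mul_inv_cancel₀ ht.ne', one_smul,
        mul_nonsing_inv A ((isUnit_iff_isUnit_det A).mp (hunit A hA))])
    (by
      rintro s hs _ ⟨t, ht, A, hA, rfl⟩
      exact ⟨s * t, mul_pos hs ht, A, hA, smul_smul s t A⟩)
    (by
      rintro _ ⟨t, ht, A, hA, rfl⟩ i
      have h := hdiag A hA i
      exact Complex.nonneg_iff.mpr
        ⟨by simpa using mul_nonneg ht.le h.1, by simp [h.2]⟩)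
    (fun y x hy hx => by
      by_contra! H
      have hA : ∀ A ∈ G, y ⬝ᵥ A *ᵥ x = 0 := fun A hA =>
        H A ⟨1, one_pos, A, hA, (one_smul _ _).symm⟩
      let p : Submodule ℂ (Fin n → ℂ) :=
        { carrier := {z | ∀ A ∈ G, y ⬝ᵥ A *ᵥ z = 0}
          add_mem' := fun {a b} ha hb A hA => by
            rw [mulVec_add, dotProduct_add, ha A hA, hb A hA, add_zero]
          zero_mem' := fun A _ => by rw [mulVec_zero, dotProduct_zero]
          smul_mem' := fun c z hz A hA => by
            rw [mulVec_smul, dotProduct_smul, hz A hA, smul_zero] }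
      rcases hirr p (fun A hA z hz B hB => by
        rw [mulVec_mulVec]
        exact hz _ (hmul B hB A hA)) with hp | hp
      · exact hx ((Submodule.mem_bot ℂ).mp (hp ▸ (show x ∈ p from hA)))
      · refine hy (funext fun i => ?_)
        have h : Pi.single i 1 ∈ p := hp ▸ Submodule.mem_top
        simpa only [one_mulVec, dotProduct_single, mul_one, Pi.zero_apply] using h 1 hone)
  refine ⟨fun i => (l i)⁻¹, fun i => inv_ne_zero (hl i), fun A hA => ?_⟩
  choose σ t ht hσ using hG A ⟨1, one_pos, A, hA, (one_smul _ _).symm⟩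
  have hentry : ∀ i j, (diagonal (fun i => (l i)⁻¹) * A *
      diagonal (fun i => ((l i)⁻¹)⁻¹)) j i = if j = σ i then (t i : ℂ) else 0 := fun i j => by
    have h := congrFun (hσ i) j
    rw [mulVec_single] at h
    rw [mul_diagonal, diagonal_mul, inv_inv, mul_assoc]
    have h' : A j i * l i = (Pi.single (σ i) (t i * l (σ i)) : Fin n → ℂ) j := by
      simpa [mul_comm] using h
    rw [h']
    split_ifs with hj
    · subst hj
      rw [Pi.single_eq_same, mul_comm, mul_assoc, mul_inv_cancel₀ (hl _), mul_one]
    · rw [Pi.single_eq_of_ne hj, mul_zero]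
  have htc : ∀ i, (t i : ℂ) ≠ 0 := fun i => Complex.ofReal_ne_zero.mpr (ht i).ne'
  have hinj : Function.Injective σ := fun i i' hii => by
    by_contra hne
    have h : A *ᵥ ((t i' : ℂ) • Pi.single i (l i)) = A *ᵥ ((t i : ℂ) • Pi.single i' (l i')) := by
      rw [mulVec_smul, mulVec_smul, hσ, hσ, hii, ← Pi.single_smul, ← Pi.single_smul,
        smul_eq_mul, smul_eq_mul, mul_left_comm]
    have h' := congrFun (mulVec_injective_iff_isUnit.mpr (hunit A hA) h) i
    simp [hne, htc, hl] at h'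
  have hbij := Finite.injective_iff_bijective.mp hinj
  have hne : ∀ i j, (diagonal (fun i => (l i)⁻¹) * A *
      diagonal (fun i => ((l i)⁻¹)⁻¹)) j i ≠ 0 ↔ j = σ i := fun i j => by
    rw [hentry, ne_eq, ite_eq_right_iff, not_forall]
    exact ⟨fun h => h.1, fun h => ⟨h, htc i⟩⟩
  refine ⟨fun j i => ?_, fun j => ?_, fun i => ?_, fun j i hji => ?_⟩
  · rw [hentry]
    split_ifs
    · exact ⟨(ht i).le, Complex.ofReal_im _⟩
    · exact ⟨le_rfl, rfl⟩
  · obtain ⟨i, rfl⟩ := hbij.2 j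
    exact ⟨i, (hne i _).mpr rfl, fun k hk => hinj ((hne k _).mp hk).symm⟩
  · exact ⟨σ i, (hne i _).mpr rfl, fun k hk => (hne i k).mp hk⟩
  · rw [hentry, if_pos ((hne i j).mp hji)]
    exact ht i
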